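/- Let (A, *, ∘) be a left skew brace and define r : A × A → A × A by r(x, y) = (x^{-*} * (x ∘ y), (x^{-*} * (x ∘ y))^{-∘} ∘ x ∘ y). Then r satisfies the set-theoretic Yang–Baxter (braid) relation (r × id)(id × r)(r × id) = (id × r)(r × id)(id × r) as maps A × A × A → A × A × A. -/

import Mathlib

/-- A digroup: a set with two group structures sharing the same identity element.
`mul`/`inv` is the `*` structure, `cmul`/`cinv` is the `∘` structure. -/
structure DiGroup (A : Type*) where
  mul : A → A → A
  one : A
  inv : A → A
  mul_assoc : ∀ a b c, mul (mul a b) c = mul a (mul b c)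
  one_mul : ∀ a, mul one a = a
  mul_one : ∀ a, mul a one = a
  inv_mul : ∀ a, mul (inv a) a = one
  mul_inv : ∀ a, mul a (inv a) = one
  cmul : A → A → A
  cinv : A → A
  cmul_assoc : ∀ a b c, cmul (cmul a b) c = cmul a (cmul b c)
  one_cmul : ∀ a, cmul one a = a
  cmul_one : ∀ a, cmul a one = a
  cinv_cmul : ∀ a, cmul (cinv a) a = one
  cmul_cinv : ∀ a, cmul a (cinv a) = one

/-- A left skew brace: a digroup satisfying `a ∘ (b * c) = (a ∘ b) * a⁻¹ * (a ∘ c)`. -/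
structure SkewBrace (A : Type*) extends DiGroup A where
  brace : ∀ a b c, cmul a (mul b c) = mul (mul (cmul a b) (inv a)) (cmul a c)

/-- The map `λ_a(u) = a⁻* * (a ∘ u)`. -/
def lam {A : Type*} (D : DiGroup A) (a u : A) : A := D.mul (D.inv a) (D.cmul a u)

/-- The map `r(x,y) = (x⁻* * (x ∘ y), (x⁻* * (x ∘ y))⁻∘ ∘ x ∘ y)`. -/
def ybeMap {A : Type*} (S : SkewBrace A) : A × A → A × A := fun p =>
  (lam S.toDiGroup p.1 p.2,
   S.cmul (S.cmul (S.cinv (lam S.toDiGroup p.1 p.2)) p.1) p.2)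

/-- `r × id` on `A × A × A`. -/
def ybeMap12 {A : Type*} (S : SkewBrace A) : A × A × A → A × A × A := fun t =>
  ((ybeMap S (t.1, t.2.1)).1, (ybeMap S (t.1, t.2.1)).2, t.2.2)

/-- `id × r` on `A × A × A`. -/
def ybeMap23 {A : Type*} (S : SkewBrace A) : A × A × A → A × A × A := fun t =>
  (t.1, ybeMap S t.2)

theorem aux_cancel {A : Type*} (S : SkewBrace A) {a b c : A} (h : S.cmul a b = S.cmul a c) :
    b = c := by
  rw [← S.one_cmul b, ← S.cinv_cmul a, S.cmul_assoc, h, ← S.cmul_assoc, S.cinv_cmul, S.one_cmul]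

theorem aux_mul_lam {A : Type*} (S : SkewBrace A) (a b : A) :
    S.mul a (lam S.toDiGroup a b) = S.cmul a b := by
  unfold lam
  rw [← S.mul_assoc, S.mul_inv, S.one_mul]

theorem aux_mcancel {A : Type*} (S : SkewBrace A) {a b c : A} (h : S.mul a b = S.mul a c) :
    b = c := by
  rw [← S.one_mul b, ← S.inv_mul a, S.mul_assoc, h, ← S.mul_assoc, S.inv_mul, S.one_mul]

theorem aux_lam_mul {A : Type*} (S : SkewBrace A) (a b c : A) :
    lam S.toDiGroup a (S.mul b c) = S.mul (lam S.toDiGroup a b) (lam S.toDiGroup a c) := by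
  unfold lam
  rw [S.brace]
  simp only [S.mul_assoc]

theorem aux_lam_lam {A : Type*} (S : SkewBrace A) (a b c : A) :
    lam S.toDiGroup a (lam S.toDiGroup b c) = lam S.toDiGroup (S.cmul a b) c := by
  apply aux_mcancel S (a := S.cmul a b)
  rw [aux_mul_lam, ← aux_mul_lam S a b, S.mul_assoc, ← aux_lam_mul, aux_mul_lam, aux_mul_lam,
    aux_mul_lam, S.cmul_assoc]

theorem aux_r {A : Type*} (S : SkewBrace A) (x y : A) :
    S.cmul (ybeMap S (x, y)).1 (ybeMap S (x, y)).2 = S.cmul x y := by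
  simp only [ybeMap]
  rw [← S.cmul_assoc, ← S.cmul_assoc, S.cmul_cinv, S.one_cmul]

/-- `r` satisfies the set-theoretic Yang–Baxter (braid) relation. -/
theorem ybe {A : Type*} (S : SkewBrace A) :
    ∀ t : A × A × A,
      ybeMap12 S (ybeMap23 S (ybeMap12 S t)) = ybeMap23 S (ybeMap12 S (ybeMap23 S t)) := by
  rintro ⟨x, y, z⟩
  have hr1 : ∀ x y, (ybeMap S (x, y)).1 = lam S.toDiGroup x y := fun _ _ => rfl
  have hr := aux_r S
  simp only [hr1] at hr
  simp only [ybeMap12, ybeMap23, hr1]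
  generalize hv : (ybeMap S (x, y)).2 = v
  have h1 := hr x y
  rw [hv] at h1
  have e1 : ybeMap S (v, z) = (lam S.toDiGroup v z, (ybeMap S (v, z)).2) := rfl
  have e2 : ybeMap S (y, z) = (lam S.toDiGroup y z, (ybeMap S (y, z)).2) := rfl
  rw [e1, e2]
  have h2 := hr v z
  have h3 := hr y z
  generalize (ybeMap S (v, z)).2 = w at *
  generalize (ybeMap S (y, z)).2 = b at *
  have h4 := hr (lam S.toDiGroup x y) (lam S.toDiGroup v z)
  have h5 := hr x (lam S.toDiGroup y z)
  generalize (ybeMap S (lam S.toDiGroup x y, lam S.toDiGroup v z)).2 = p at *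
  generalize (ybeMap S (x, lam S.toDiGroup y z)).2 = c at *
  have e3 : ybeMap S (c, b) = (lam S.toDiGroup c b, (ybeMap S (c, b)).2) := rfl
  rw [e3]
  have h6 := hr c b
  generalize (ybeMap S (c, b)).2 = d at *
  have k1 : lam S.toDiGroup (lam S.toDiGroup x y) (lam S.toDiGroup v z)
      = lam S.toDiGroup x (lam S.toDiGroup y z) := by
    rw [aux_lam_lam, aux_lam_lam, h1]
  have k2 : p = lam S.toDiGroup c b := by
    apply aux_cancel S (a := lam S.toDiGroup x (lam S.toDiGroup y z))
    rw [← aux_mul_lam S _ (lam S.toDiGroup c b), aux_lam_lam S _ c b, h5, ← aux_lam_lam,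
      ← aux_lam_mul, aux_mul_lam, h3, ← k1, h4, ← aux_mul_lam, k1, ← aux_lam_mul, aux_mul_lam]
  have k3 : w = d := by
    apply aux_cancel S (a := p)
    apply aux_cancel S (a := lam S.toDiGroup x (lam S.toDiGroup y z))
    rw [← S.cmul_assoc, ← k1, h4, S.cmul_assoc, h2, ← S.cmul_assoc, h1, k1, k2, h6,
      ← S.cmul_assoc, h5, S.cmul_assoc, S.cmul_assoc, h3]
  rw [k1, k2, k3]
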